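/- Let p be a prime with p ≡ 3 (mod 4). For all i, j ∈ F_p, the (i,j) entry of the n-th matrix power Aⁿ of the random-walk kernel A converges, as n → ∞, to π(j); that is, lim_{n→∞} (Aⁿ)(i,j) = π(j). -/

import Mathlib

open Finset

/-- The circle of quadrance `K` centered at the origin in `F_p × F_p`. -/
def circ (p : ℕ) [NeZero p] (K : ZMod p) : Finset (ZMod p × ZMod p) :=
  Finset.univ.filter (fun v => v.1 ^ 2 + v.2 ^ 2 = K)

/-- `N_{ij}^k`: the number of pairs `(a, b)` with `a ∈ C_i`, `b ∈ C_j`, `a + b ∈ C_k`. -/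
def Ncirc (p : ℕ) [NeZero p] (i j k : ZMod p) : ℕ :=
  ((circ p i ×ˢ circ p j).filter (fun ab => ab.1 + ab.2 ∈ circ p k)).card

/-- The random-walk kernel of the unit circle: `A(i,j) = N_{i1}^j / (|C_i|·|C_1|)`. -/
noncomputable def kerA (p : ℕ) [NeZero p] : Matrix (ZMod p) (ZMod p) ℝ :=
  fun i j => (Ncirc p i 1 j : ℝ) / (((circ p i).card : ℝ) * ((circ p 1).card : ℝ))

/-- The stationary distribution: `π(0) = 1/p²`, `π(j) = (p+1)/p²` for `j ≠ 0`. -/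
noncomputable def piDist (p : ℕ) [NeZero p] (j : ZMod p) : ℝ :=
  if j = 0 then 1 / (p : ℝ) ^ 2 else ((p : ℝ) + 1) / (p : ℝ) ^ 2


section Aux

variable {p : ℕ} [Fact p.Prime]

lemma mem_circ (K : ZMod p) (v : ZMod p × ZMod p) :
    v ∈ circ p K ↔ v.1 ^ 2 + v.2 ^ 2 = K := by
  simp [circ]

lemma circ_zero (hp : p % 4 = 3) : circ p 0 = {(0, 0)} := by
  ext ⟨x, y⟩
  rw [mem_circ, Finset.mem_singleton, Prod.mk.injEq]
  constructor
  · intro h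
    have hns : ¬ IsSquare (-1 : ZMod p) := by
      rw [ZMod.exists_sq_eq_neg_one_iff]
      omega
    have hy : y = 0 := by
      by_contra hy
      apply hns
      refine ⟨x / y, ?_⟩
      field_simp
      simp only at h
      linear_combination -h
    subst hy
    simpa using h
  · rintro ⟨rfl, rfl⟩
    simp

lemma exists_circ (K : ZMod p) : ∃ v : ZMod p × ZMod p, v.1 ^ 2 + v.2 ^ 2 = K := by
  obtain ⟨a, b, h⟩ := ZMod.sq_add_sq p K
  exact ⟨(a, b), h⟩

lemma circ_card_pos (K : ZMod p) : 0 < (circ p K).card := by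
  obtain ⟨v, hv⟩ := exists_circ K
  exact Finset.card_pos.mpr ⟨v, (mem_circ _ _).2 hv⟩

lemma circ_card_le (i k : ZMod p) (hk : k ≠ 0) : (circ p i).card ≤ (circ p (k * i)).card := by
  obtain ⟨⟨t, s⟩, hv⟩ := exists_circ k
  simp only at hv
  apply Finset.card_le_card_of_injOn (fun w => (t * w.1 - s * w.2, t * w.2 + s * w.1))
  · rintro ⟨x, y⟩ hw
    have hw := (mem_circ _ _).1 hw
    apply (mem_circ _ _).2
    simp only at hw ⊢
    rw [← hw, ← hv]; ring
  · rintro ⟨x, y⟩ - ⟨z, w⟩ - h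
    simp only [Prod.mk.injEq] at h ⊢
    obtain ⟨h1, h2⟩ := h
    constructor
    · apply mul_left_cancel₀ hk
      rw [← hv]
      linear_combination t * h1 + s * h2
    · apply mul_left_cancel₀ hk
      rw [← hv]
      linear_combination t * h2 - s * h1

lemma circ_card_eq (k : ZMod p) (hk : k ≠ 0) : (circ p k).card = (circ p 1).card := by
  apply le_antisymm
  · have := circ_card_le k k⁻¹ (inv_ne_zero hk)
    rwa [inv_mul_cancel₀ hk] at this
  · have := circ_card_le 1 k hk
    rwa [mul_one] at this

lemma sum_circ_card : ∑ k : ZMod p, (circ p k).card = p ^ 2 := by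
  have := Finset.card_eq_sum_card_fiberwise (s := (Finset.univ : Finset (ZMod p × ZMod p)))
    (t := (Finset.univ : Finset (ZMod p))) (f := fun v => v.1 ^ 2 + v.2 ^ 2)
    (fun _ _ => by simp)
  rw [Finset.card_univ, Fintype.card_prod, ZMod.card] at this
  rw [sq, this]
  rfl

lemma circ_card (hp : p % 4 = 3) (k : ZMod p) (hk : k ≠ 0) : (circ p k).card = p + 1 := by
  rw [circ_card_eq k hk]
  have h := sum_circ_card (p := p)
  rw [← Finset.add_sum_erase _ _ (Finset.mem_univ (0 : ZMod p)), circ_zero hp,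
    Finset.sum_congr rfl (fun k hk => circ_card_eq k (Finset.ne_of_mem_erase hk)),
    Finset.sum_const, Finset.card_erase_of_mem (Finset.mem_univ _), Finset.card_univ,
    ZMod.card] at h
  simp only [Finset.card_singleton, smul_eq_mul] at h
  obtain ⟨q, hq⟩ : ∃ q, p = q + 2 := ⟨p - 2, by omega⟩
  have hq' : p - 1 = q + 1 := by omega
  rw [hq'] at h
  apply Nat.eq_of_mul_eq_mul_left (Nat.succ_pos q)
  have : 1 + (q + 1) * (circ p 1).card = 1 + (q + 1) * (p + 1) := by
    rw [h, hq]; ring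
  simpa using this

lemma piDist_eq (hp : p % 4 = 3) (k : ZMod p) :
    piDist p k = ((circ p k).card : ℝ) / (p : ℝ) ^ 2 := by
  unfold piDist
  split_ifs with h
  · rw [h, circ_zero hp]; simp
  · rw [circ_card hp k h]; push_cast; rfl

lemma sum_Ncirc (i : ZMod p) :
    ∑ j : ZMod p, Ncirc p i 1 j = (circ p i).card * (circ p 1).card := by
  rw [← Finset.card_product]
  rw [Finset.card_eq_sum_card_fiberwise (t := (Finset.univ : Finset (ZMod p)))
    (f := fun ab => (ab.1 + ab.2).1 ^ 2 + (ab.1 + ab.2).2 ^ 2) (fun _ _ => by simp)]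
  apply Finset.sum_congr rfl
  intro j _
  unfold Ncirc
  simp only [mem_circ]

lemma sum_Ncirc' (j : ZMod p) :
    ∑ i : ZMod p, Ncirc p i 1 j = (circ p j).card * (circ p 1).card := by
  rw [← Finset.card_product]
  rw [Finset.card_eq_sum_card_fiberwise (t := (Finset.univ : Finset (ZMod p)))
    (f := fun ab => (ab.1 - ab.2).1 ^ 2 + (ab.1 - ab.2).2 ^ 2) (fun _ _ => by simp)]
  apply Finset.sum_congr rfl
  intro i _
  unfold Ncirc
  apply Finset.card_bij' (fun ab _ => (ab.1 + ab.2, ab.2)) (fun ab _ => (ab.1 - ab.2, ab.2))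
  · rintro ⟨a, b⟩ h
    simp
  · rintro ⟨a, b⟩ h
    simp
  · rintro ⟨a, b⟩ h
    simp only [Finset.mem_filter, Finset.mem_product, mem_circ] at h ⊢
    simp only [add_sub_cancel_right]
    tauto
  · rintro ⟨a, b⟩ h
    simp only [Finset.mem_filter, Finset.mem_product, mem_circ] at h ⊢
    simp only [sub_add_cancel]
    tauto

lemma kerA_nonneg (i j : ZMod p) : 0 ≤ kerA p i j := by
  unfold kerA; positivity

lemma kerA_row (i : ZMod p) : ∑ j, kerA p i j = 1 := by
  unfold kerA
  have h1 : ((circ p i).card : ℝ) ≠ 0 := by exact_mod_cast (circ_card_pos i).ne'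
  have h2 : ((circ p 1).card : ℝ) ≠ 0 := by exact_mod_cast (circ_card_pos (p := p) 1).ne'
  rw [← Finset.sum_div, ← Nat.cast_sum, sum_Ncirc]
  push_cast
  field_simp

lemma kerA_stat (hp : p % 4 = 3) (j : ZMod p) : ∑ i, piDist p i * kerA p i j = piDist p j := by
  have h2 : ((circ p 1).card : ℝ) ≠ 0 := by exact_mod_cast (circ_card_pos (p := p) 1).ne'
  have : ∀ i, piDist p i * kerA p i j
      = (Ncirc p i 1 j : ℝ) / ((p : ℝ) ^ 2 * ((circ p 1).card : ℝ)) := by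
    intro i
    have h1 : ((circ p i).card : ℝ) ≠ 0 := by exact_mod_cast (circ_card_pos i).ne'
    have h3 : (p : ℝ) ≠ 0 := by exact_mod_cast (Fact.out : p.Prime).ne_zero
    rw [piDist_eq hp]
    unfold kerA
    field_simp
  simp_rw [this]
  rw [← Finset.sum_div, ← Nat.cast_sum, sum_Ncirc', piDist_eq hp]
  push_cast
  have h3 : (p : ℝ) ≠ 0 := by exact_mod_cast (Fact.out : p.Prime).ne_zero
  field_simp

lemma piDist_pos (hp : p % 4 = 3) (j : ZMod p) : 0 < piDist p j := by
  rw [piDist_eq hp]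
  have h1 : (0 : ℝ) < ((circ p j).card : ℝ) := by exact_mod_cast circ_card_pos j
  have h3 : (0 : ℝ) < (p : ℝ) := by exact_mod_cast (Fact.out : p.Prime).pos
  positivity

lemma piDist_sum (hp : p % 4 = 3) : ∑ j, piDist p j = 1 := by
  simp_rw [piDist_eq hp]
  rw [← Finset.sum_div, ← Nat.cast_sum, sum_circ_card]
  have h3 : (p : ℝ) ≠ 0 := by exact_mod_cast (Fact.out : p.Prime).ne_zero
  push_cast
  field_simp

/-- the quadrance -/
def qd (v : ZMod p × ZMod p) : ZMod p := v.1 ^ 2 + v.2 ^ 2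

lemma kerA_step (v e : ZMod p × ZMod p) (he : qd e = 1) : 0 < kerA p (qd v) (qd (v + e)) := by
  unfold kerA
  have h1 : (0 : ℝ) < ((circ p (qd v)).card : ℝ) := by exact_mod_cast circ_card_pos _
  have h2 : (0 : ℝ) < ((circ p 1).card : ℝ) := by exact_mod_cast circ_card_pos (p := p) 1
  have h3 : 0 < Ncirc p (qd v) 1 (qd (v + e)) := by
    unfold Ncirc
    refine Finset.card_pos.mpr ⟨(v, e), ?_⟩
    simp only [Finset.mem_filter, Finset.mem_product, mem_circ]
    exact ⟨⟨rfl, he⟩, rfl⟩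
  have h4 : (0 : ℝ) < (Ncirc p (qd v) 1 (qd (v + e)) : ℝ) := by exact_mod_cast h3
  positivity

lemma kerA_pow_nonneg (n : ℕ) (i j : ZMod p) : 0 ≤ (kerA p ^ n) i j := by
  induction n generalizing i j with
  | zero => rw [pow_zero, Matrix.one_apply]; split_ifs <;> norm_num
  | succ n ih =>
    rw [pow_succ, Matrix.mul_apply]
    exact Finset.sum_nonneg fun k _ => mul_nonneg (ih _ _) (kerA_nonneg _ _)

lemma kerA_pow_comp {m n : ℕ} {i j k : ZMod p} (h1 : 0 < (kerA p ^ m) i j)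
    (h2 : 0 < (kerA p ^ n) j k) : 0 < (kerA p ^ (m + n)) i k := by
  rw [pow_add, Matrix.mul_apply]
  exact Finset.sum_pos' (fun l _ => mul_nonneg (kerA_pow_nonneg _ _ _) (kerA_pow_nonneg _ _ _))
    ⟨j, Finset.mem_univ _, mul_pos h1 h2⟩

lemma kerA_steps (e : ZMod p × ZMod p) (he : qd e = 1) (n : ℕ) (v : ZMod p × ZMod p) :
    0 < (kerA p ^ n) (qd v) (qd (v + n • e)) := by
  induction n with
  | zero => simp
  | succ n ih =>
    refine kerA_pow_comp ih ?_
    rw [pow_one, succ_nsmul, ← add_assoc]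
    exact kerA_step _ _ he

lemma kerA_line (hp : p % 4 = 3) (e : ZMod p × ZMod p) (he : qd e = 1) (d : ZMod p)
    (v : ZMod p × ZMod p) : 0 < (kerA p ^ p) (qd v) (qd (v + d • e)) := by
  have h2 : (2 : ZMod p) ≠ 0 := by
    intro h
    have : ((2 : ℕ) : ZMod p) = 0 := by exact_mod_cast h
    rw [ZMod.natCast_eq_zero_iff] at this
    have := Nat.le_of_dvd (by norm_num) this
    omega
  set a := (d / 2).val with ha
  have hap : a ≤ p := (ZMod.val_lt _).le
  have hac : (a : ZMod p) = d / 2 := by rw [ha, ZMod.natCast_zmod_val]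
  have hne : qd (-e) = 1 := by rw [← he]; simp [qd]
  have := kerA_pow_comp (kerA_steps e he a v) (kerA_steps (-e) hne (p - a) (v + a • e))
  rw [Nat.add_sub_cancel' hap] at this
  convert this using 2
  rw [add_assoc]
  congr 1
  ext
  all_goals
    simp only [Prod.fst_add, Prod.snd_add, Prod.smul_fst, Prod.smul_snd, Prod.fst_neg,
      Prod.snd_neg]
    simp only [nsmul_eq_mul, smul_eq_mul, Nat.cast_sub hap, hac, CharP.cast_eq_zero]
    field_simp
    ring

lemma kerA_pow_pos (hp : p % 4 = 3) (i j : ZMod p) : 0 < (kerA p ^ (p + p)) i j := by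
  obtain ⟨v, rfl⟩ := exists_circ i
  obtain ⟨w, rfl⟩ := exists_circ j
  have h1 := kerA_line hp (1, 0) (by simp [qd]) (w.1 - v.1) v
  have h2 := kerA_line hp (0, 1) (by simp [qd]) (w.2 - v.2) (v + (w.1 - v.1) • (1, 0))
  have h := kerA_pow_comp h1 h2
  have hw : v + (w.1 - v.1) • ((1, 0) : ZMod p × ZMod p)
      + (w.2 - v.2) • ((0, 1) : ZMod p × ZMod p) = w := by
    ext <;> simp
  rw [hw] at h
  exact h

end Aux

/-- Doeblin-type convergence for finite stochastic matrices. -/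
lemma doeblin {ι : Type*} [Fintype ι] [DecidableEq ι] [Nonempty ι] (A : Matrix ι ι ℝ) (π : ι → ℝ)
    (hnn : ∀ i j, 0 ≤ A i j) (hrow : ∀ i, ∑ j, A i j = 1) (hstat : ∀ j, ∑ i, π i * A i j = π j)
    (hπ : ∀ j, 0 < π j) (hsum : ∑ j, π j = 1) (m : ℕ) (hm : ∀ i j, 0 < (A ^ m) i j) (i j : ι) :
    Filter.Tendsto (fun n : ℕ => (A ^ n) i j) Filter.atTop (nhds (π j)) := by
  classical
  have hrow' : ∀ n i, ∑ j, (A ^ n) i j = 1 := by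
    intro n
    induction n with
    | zero => intro i; simp [Matrix.one_apply]
    | succ n ih =>
      intro i
      simp_rw [pow_succ, Matrix.mul_apply]
      rw [Finset.sum_comm]
      simp_rw [← Finset.mul_sum, hrow, mul_one, ih]
  have hstat' : ∀ n j, ∑ i, π i * (A ^ n) i j = π j := by
    intro n
    induction n with
    | zero => intro j; simp [Matrix.one_apply]
    | succ n ih =>
      intro j
      simp_rw [pow_succ, Matrix.mul_apply, Finset.mul_sum]
      rw [Finset.sum_comm]
      simp_rw [← mul_assoc, ← Finset.sum_mul, ih, hstat]
  -- a uniform lower bound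
  obtain ⟨⟨a, b⟩, hab⟩ := Finite.exists_min (fun x : ι × ι => (A ^ m) x.1 x.2)
  set ε := min ((A ^ m) a b) (1 / 2) with hε
  have hε0 : 0 < ε := lt_min (hm a b) (by norm_num)
  have hε1 : ε ≤ 1 / 2 := min_le_right _ _
  have hπ1 : ∀ k, π k ≤ 1 := fun k => by
    rw [← hsum]
    exact Finset.single_le_sum (f := π) (fun l _ => (hπ l).le) (Finset.mem_univ k)
  have hlow : ∀ i k, ε * π k ≤ (A ^ m) i k := fun i k =>
    calc ε * π k ≤ ε * 1 := by gcongr; exact hπ1 k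
      _ = ε := mul_one _
      _ ≤ (A ^ m) a b := min_le_left _ _
      _ ≤ (A ^ m) i k := hab (i, k)
  -- key contraction
  have hcon : ∀ (f : ι → ℝ) (C : ℝ), (∑ k, π k * f k = 0) → (∀ k, |f k| ≤ C) →
      ∀ i, |∑ k, (A ^ m) i k * f k| ≤ (1 - ε) * C := by
    intro f C hf hC i
    have : ∑ k, (A ^ m) i k * f k = ∑ k, ((A ^ m) i k - ε * π k) * f k := by
      simp_rw [sub_mul, Finset.sum_sub_distrib, mul_assoc, ← Finset.mul_sum, hf]
      ring
    rw [this]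
    calc |∑ k, ((A ^ m) i k - ε * π k) * f k|
        ≤ ∑ k, |((A ^ m) i k - ε * π k) * f k| := Finset.abs_sum_le_sum_abs _ _
      _ ≤ ∑ k, ((A ^ m) i k - ε * π k) * C := by
        apply Finset.sum_le_sum
        intro k _
        have h0 : 0 ≤ (A ^ m) i k - ε * π k := sub_nonneg.2 (hlow i k)
        rw [abs_mul, abs_of_nonneg h0]
        exact mul_le_mul_of_nonneg_left (hC k) h0
      _ = (1 - ε) * C := by
        rw [← Finset.sum_mul, Finset.sum_sub_distrib, ← Finset.mul_sum, hrow', hsum, mul_one]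
  have hmean : ∀ n, ∑ k, π k * ((A ^ n) k j - π j) = 0 := by
    intro n
    simp_rw [mul_sub, Finset.sum_sub_distrib, ← Finset.sum_mul, hstat', hsum]
    ring
  have hone : ∀ n i, (A ^ (n + 1)) i j - π j = ∑ k, A i k * ((A ^ n) k j - π j) := by
    intro n i
    simp_rw [mul_sub, Finset.sum_sub_distrib, ← Finset.sum_mul, hrow, pow_succ', Matrix.mul_apply]
    ring
  have hmm : ∀ n i, (A ^ (m + n)) i j - π j = ∑ k, (A ^ m) i k * ((A ^ n) k j - π j) := by
    intro n i
    simp_rw [mul_sub, Finset.sum_sub_distrib, ← Finset.sum_mul, hrow', pow_add, Matrix.mul_apply]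
    ring
  have hA : ∀ (r : ℕ) k, |(A ^ r) k j - π j| ≤ 1 := by
    intro r
    induction r with
    | zero =>
      intro k
      have h1 := hπ1 j
      have h2 := hπ j
      rw [pow_zero, Matrix.one_apply, abs_le]
      split_ifs <;> constructor <;> linarith
    | succ r ih =>
      intro k
      rw [hone]
      calc _ ≤ ∑ l, |A k l * ((A ^ r) l j - π j)| := Finset.abs_sum_le_sum_abs _ _
        _ ≤ ∑ l, A k l * 1 := by
          apply Finset.sum_le_sum
          intro l _
          rw [abs_mul, abs_of_nonneg (hnn k l)]
          exact mul_le_mul_of_nonneg_left (ih l) (hnn k l)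
        _ = 1 := by simp [hrow]
  have hgeo : ∀ (q r : ℕ) k, |(A ^ (m * q + r)) k j - π j| ≤ (1 - ε) ^ q := by
    intro q r
    induction q with
    | zero => intro k; simpa using hA r k
    | succ q ih =>
      intro k
      have : m * (q + 1) + r = m + (m * q + r) := by ring
      rw [this, hmm, pow_succ']
      exact hcon _ _ (hmean _) ih k
  rw [tendsto_iff_dist_tendsto_zero]
  have hlim : Filter.Tendsto (fun q : ℕ => (1 - ε) ^ q) Filter.atTop (nhds 0) :=
    tendsto_pow_atTop_nhds_zero_of_lt_one (by linarith) (by linarith)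
  rw [Metric.tendsto_atTop] at hlim ⊢
  intro δ hδ
  obtain ⟨q, hq⟩ := hlim δ hδ
  refine ⟨m * q, fun n hn => ?_⟩
  obtain ⟨r, rfl⟩ := Nat.exists_eq_add_of_le hn
  have h1 := hgeo q r i
  have h2 := hq q le_rfl
  rw [Real.dist_0_eq_abs] at h2 ⊢
  rw [Real.dist_eq, abs_abs]
  exact (h1.trans (le_abs_self _)).trans_lt h2

/-- `(Aⁿ)(i,j) → π(j)` as `n → ∞`. -/
theorem kerA_pow_tendsto (p : ℕ) [Fact p.Prime] (hp : p % 4 = 3) (i j : ZMod p) :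
    Filter.Tendsto (fun n : ℕ => (kerA p ^ n) i j) Filter.atTop (nhds (piDist p j)) := by
  exact doeblin (kerA p) (piDist p) kerA_nonneg kerA_row (kerA_stat hp) (piDist_pos hp)
    (piDist_sum hp) (p + p) (kerA_pow_pos hp) i j
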